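/- Let q be a prime power, n ≥ 2 an integer, a, b ∈ F_q^*, and d := gcd(q − 1, n). Then |N_n(a,b) − (q^{n−1} − 1)/(q − 1)| ≤ (1 + (q − 2)·q^{(n−1)/2} − q^{(n−2)/2}·(q^{1/2} − 1)·(d − 1))/(q − 1), where the inequality is between real numbers and fractional powers of q are real powers. -/

import Mathlib

open Finset

/-- The composite of a multiplicative character with the field norm. -/
noncomputable def MulChar.compNorm {F : Type*} (E : Type*) [Field F] [Field E] [Fintype F]
    [Fintype E] [Algebra F E] (χ : MulChar F ℂ) : MulChar E ℂ where
  toMonoidHom := χ.toMonoidHom.comp (Algebra.norm F)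
  map_nonunit' z hz := by
    have : z = 0 := by simpa using hz
    subst this
    simp

/-- The composite of an additive character with the field trace. -/
noncomputable def AddChar.compTrace {F : Type*} (E : Type*) [Field F] [Field E]
    [Algebra F E] (ψ : AddChar F ℂ) : AddChar E ℂ :=
  ψ.compAddMonoidHom (Algebra.trace F E).toAddMonoidHom

@[simp]
lemma AddChar.compTrace_apply {F E : Type*} [Field F] [Field E] [Algebra F E]
    (ψ : AddChar F ℂ) (z : E) :
    ψ.compTrace E z = ψ (Algebra.trace F E z) := rfl

section Characters

variable {F E : Type*} [Field F] [Field E] [Fintype F] [Fintype E] [Algebra F E]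

@[simp]
lemma MulChar.compNorm_apply (χ : MulChar F ℂ) (z : E) :
    χ.compNorm E z = χ (Algebra.norm F z) := rfl

@[simp]
lemma MulChar.compNorm_one : (1 : MulChar F ℂ).compNorm E = 1 := by
  ext z
  have hz : Algebra.norm F (z : E) ≠ 0 := by simp
  rw [compNorm_apply, MulChar.one_apply hz.isUnit, MulChar.one_apply z.isUnit]

lemma MulChar.compNorm_ne_one {χ : MulChar F ℂ} (hχ : χ ≠ 1) : χ.compNorm E ≠ 1 := by
  rw [MulChar.ne_one_iff] at hχ ⊢
  obtain ⟨u, hu⟩ := hχ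
  obtain ⟨z, hz⟩ := FiniteField.unitsMap_norm_surjective F E u
  refine ⟨z, ?_⟩
  rw [compNorm_apply]
  rwa [← hz] at hu

lemma AddChar.compTrace_isPrimitive {ψ : AddChar F ℂ} (hψ : ψ ≠ 1) :
    (ψ.compTrace E).IsPrimitive := by
  apply AddChar.IsPrimitive.of_ne_one
  rw [AddChar.ne_one_iff] at hψ ⊢
  obtain ⟨x, hx⟩ := hψ
  obtain ⟨z, rfl⟩ := Algebra.trace_surjective F E x
  exact ⟨z, hx⟩

lemma norm_gaussSum_eq_sqrt_card {χ : MulChar F ℂ} (hχ : χ ≠ 1) {ψ : AddChar F ℂ}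
    (hψ : ψ.IsPrimitive) : ‖gaussSum χ ψ‖ = √(Fintype.card F) := by
  have h := gaussSum_mul_gaussSum_eq_card hχ hψ
  rw [← star_gaussSum_eq, RCLike.star_def, Complex.mul_conj'] at h
  rw [eq_comm, Real.sqrt_eq_iff_eq_sq (by positivity) (by positivity)]
  exact_mod_cast h.symm

lemma MulChar.sum_inv_mul_apply [DecidableEq F] [Fintype (MulChar F ℂ)] {a : F} (ha : a ≠ 0)
    (x : F) :
    ∑ χ : MulChar F ℂ, χ⁻¹ a * χ x = if x = a then (Fintype.card F : ℂ) - 1 else 0 := by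
  have key (χ : MulChar F ℂ) : χ⁻¹ a * χ x = χ (a⁻¹ * x) := by
    rw [MulChar.inv_apply', map_mul]
  simp_rw [key]
  split_ifs with h
  · subst h
    simp only [inv_mul_cancel₀ ha, map_one, sum_const, card_univ, nsmul_eq_mul, mul_one]
    rw [← Nat.card_eq_fintype_card, MulChar.card_eq_card_units_of_hasEnoughRootsOfUnity,
      Nat.card_eq_fintype_card, Fintype.card_units, Nat.cast_sub Fintype.card_pos, Nat.cast_one]
  · have hne : a⁻¹ * x ≠ 1 := fun h' ↦ h (by field_simp at h'; exact h')
    obtain ⟨η, hη⟩ := MulChar.exists_apply_ne_one_of_hasEnoughRootsOfUnity F ℂ hne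
    have hs : η (a⁻¹ * x) * ∑ χ : MulChar F ℂ, χ (a⁻¹ * x) = ∑ χ : MulChar F ℂ, χ (a⁻¹ * x) := by
      rw [mul_sum]
      exact Fintype.sum_equiv (Equiv.mulLeft η) _ _ fun χ ↦ by simp [MulChar.mul_apply]
    exact eq_zero_of_mul_eq_self_left hη hs

lemma MulChar.card_filter_pow_eq_one [DecidableEq (MulChar F ℂ)] [Fintype (MulChar F ℂ)] (n : ℕ) :
    #{χ : MulChar F ℂ | χ ^ n = 1} = (Fintype.card F - 1).gcd n := by
  classical
  obtain ⟨e⟩ := MulChar.mulEquiv_units F ℂ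
  have : IsCyclic (MulChar F ℂ) := e.isCyclic.mpr inferInstance
  have h := IsCyclic.card_powMonoidHom_ker (G := MulChar F ℂ) n
  rw [MulChar.card_eq_card_units_of_hasEnoughRootsOfUnity, Nat.card_eq_fintype_card (α := Fˣ),
    Fintype.card_units] at h
  rw [← h, ← Fintype.card_subtype, ← Nat.card_eq_fintype_card]
  rfl

/-- The twisted sum over `z` detecting the trace condition. -/
lemma sum_norm_trace_eq_gaussSum {ψ : AddChar F ℂ} (χ : MulChar F ℂ) (b : F) :
    ∑ z : E, χ (Algebra.norm F z) * ∑ c, ψ (c * (Algebra.trace F E z - b)) =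
      ∑ c, ψ (c * -b) * gaussSum (χ.compNorm E) ((ψ.compTrace E).mulShift (algebraMap F E c)) := by
  simp_rw [gaussSum, mul_sum]
  rw [sum_comm]
  refine sum_congr rfl fun c _ ↦ sum_congr rfl fun z _ ↦ ?_
  rw [AddChar.mulShift_apply, MulChar.compNorm_apply, AddChar.compTrace_apply,
    ← Algebra.smul_def, map_smul, smul_eq_mul, sub_eq_add_neg, mul_add, AddChar.map_add_eq_mul]
  ring

lemma gaussSum_compNorm_mulShift (χ : MulChar F ℂ) (ψ : AddChar F ℂ) {c : F} (hc : c ≠ 0) :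
    gaussSum (χ.compNorm E) ((ψ.compTrace E).mulShift (algebraMap F E c)) =
      (χ ^ Module.finrank F E)⁻¹ c * gaussSum (χ.compNorm E) (ψ.compTrace E) := by
  have hu : algebraMap F E c ≠ 0 := by simpa
  have h := gaussSum_mulShift_eq (χ.compNorm E) (ψ.compTrace E) (Units.mk0 _ hu)
  rw [Units.val_mk0] at h
  rw [h, MulChar.inv_apply', MulChar.inv_apply', MulChar.compNorm_apply, ← map_inv₀,
    Algebra.norm_algebraMap, map_pow, MulChar.pow_apply' _ Module.finrank_pos.ne']

lemma sum_norm_trace_of_ne_one {ψ : AddChar F ℂ} {χ : MulChar F ℂ} (hχ : χ ≠ 1)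
    (b : F) :
    ∑ z : E, χ (Algebra.norm F z) * ∑ c, ψ (c * (Algebra.trace F E z - b)) =
      gaussSum (χ.compNorm E) (ψ.compTrace E) *
        gaussSum (χ ^ Module.finrank F E)⁻¹ (ψ.mulShift (-b)) := by
  rw [sum_norm_trace_eq_gaussSum, gaussSum.eq_1 (χ ^ _)⁻¹, mul_sum]
  refine sum_congr rfl fun c _ ↦ ?_
  rcases eq_or_ne c 0 with rfl | hc
  · rw [map_zero, AddChar.mulShift_zero, gaussSum_one_right (MulChar.compNorm_ne_one hχ),
      MulChar.map_zero]
    ring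
  · rw [gaussSum_compNorm_mulShift χ ψ hc, AddChar.mulShift_apply, mul_comm c]
    ring

lemma sum_norm_trace_one {ψ : AddChar F ℂ} (hψ : ψ ≠ 1) {b : F} (hb : b ≠ 0) :
    ∑ z : E, (1 : MulChar F ℂ) (Algebra.norm F z) * ∑ c, ψ (c * (Algebra.trace F E z - b)) =
      Fintype.card E := by
  classical
  have hE : (ψ.compTrace E) ≠ 1 := by
    simpa using (AddChar.compTrace_isPrimitive (E := E) hψ) one_ne_zero
  have hs : ∑ c, ψ (c * -b) = 0 := by
    simpa [hb] using AddChar.sum_mulShift (-b) (AddChar.IsPrimitive.of_ne_one hψ)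
  rw [sum_norm_trace_eq_gaussSum, MulChar.compNorm_one, ← add_sum_erase _ _ (mem_univ (0 : F))]
  rw [← add_sum_erase _ _ (mem_univ (0 : F))] at hs
  have h (c : F) (hc : c ∈ univ.erase 0) : ψ (c * -b) * gaussSum (1 : MulChar E ℂ)
      ((ψ.compTrace E).mulShift (algebraMap F E c)) = - ψ (c * -b) := by
    have hc : c ≠ 0 := by simpa using hc
    rw [gaussSum_one_left (AddChar.compTrace_isPrimitive hψ (by simpa using hc))]
    ring
  rw [sum_congr rfl h, sum_neg_distrib, ← neg_eq_of_add_eq_zero_right hs, map_zero,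
    AddChar.mulShift_zero, gaussSum_one_one, Nat.card_eq_fintype_card, Fintype.card_units,
    Nat.cast_sub Fintype.card_pos]
  simp

lemma norm_sum_norm_trace [DecidableEq (MulChar F ℂ)] {ψ : AddChar F ℂ}
    (hψ : ψ ≠ 1) {χ : MulChar F ℂ} (hχ : χ ≠ 1) {b : F} (hb : b ≠ 0) :
    ‖∑ z : E, χ (Algebra.norm F z) * ∑ c, ψ (c * (Algebra.trace F E z - b))‖ =
      √(Fintype.card E) * if χ ^ Module.finrank F E = 1 then 1 else √(Fintype.card F) := by
  have hb' : ψ.mulShift (-b) ≠ 1 := AddChar.IsPrimitive.of_ne_one hψ (neg_ne_zero.mpr hb)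
  rw [sum_norm_trace_of_ne_one hχ, norm_mul, norm_gaussSum_eq_sqrt_card
    (MulChar.compNorm_ne_one hχ) (AddChar.compTrace_isPrimitive hψ)]
  congr 1
  split_ifs with h
  · rw [h, inv_one, gaussSum_one_left hb', norm_neg, norm_one]
  · exact norm_gaussSum_eq_sqrt_card (inv_ne_one.mpr h) (AddChar.IsPrimitive.of_ne_one hb')

lemma card_norm_trace_eq_sum [Fintype (MulChar F ℂ)] {ψ : AddChar F ℂ} (hψ : ψ ≠ 1)
    {a b : F} (ha : a ≠ 0) :
    ((Fintype.card F : ℂ) - 1) * Fintype.card F *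
        Nat.card {z : E // Algebra.norm F z = a ∧ Algebra.trace F E z = b} =
      ∑ χ : MulChar F ℂ, χ⁻¹ a *
        ∑ z : E, χ (Algebra.norm F z) * ∑ c, ψ (c * (Algebra.trace F E z - b)) := by
  classical
  simp_rw [mul_sum (s := (univ : Finset E))]
  rw [sum_comm]
  simp_rw [← mul_assoc, ← sum_mul, MulChar.sum_inv_mul_apply ha,
    AddChar.sum_mulShift _ (AddChar.IsPrimitive.of_ne_one hψ), sub_eq_zero]
  rw [Nat.card_eq_fintype_card, Fintype.card_subtype, card_eq_sum_ones, sum_filter, Nat.cast_sum,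
    mul_sum]
  refine sum_congr rfl fun z _ ↦ ?_
  by_cases h₁ : Algebra.norm F z = a <;> by_cases h₂ : Algebra.trace F E z = b <;> simp [h₁, h₂]

theorem abs_card_norm_trace_sub_le {a b : F} (ha : a ≠ 0) (hb : b ≠ 0) :
    |((Fintype.card F : ℝ) - 1) * Fintype.card F *
        Nat.card {z : E // Algebra.norm F z = a ∧ Algebra.trace F E z = b} - Fintype.card E| ≤
      √(Fintype.card E) * (((Fintype.card F - 1).gcd (Module.finrank F E) - 1) +
        (Fintype.card F - 1 - (Fintype.card F - 1).gcd (Module.finrank F E)) *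
          √(Fintype.card F)) := by
  classical
  have := Fintype.ofFinite (MulChar F ℂ)
  obtain ⟨ψ, hψ⟩ : ∃ ψ : AddChar F ℂ, ψ ≠ 1 := by
    obtain ⟨ψ, hψ⟩ := AddChar.exists_apply_ne_zero.mpr (one_ne_zero (α := F))
    exact ⟨ψ, AddChar.ne_one_iff.mpr ⟨1, hψ⟩⟩
  have hcard : (Fintype.card (MulChar F ℂ) : ℝ) = Fintype.card F - 1 := by
    rw [← Nat.card_eq_fintype_card, MulChar.card_eq_card_units_of_hasEnoughRootsOfUnity,
      Nat.card_eq_fintype_card, Fintype.card_units, Nat.cast_sub Fintype.card_pos, Nat.cast_one]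
  set n := Module.finrank F E
  have hsum : ∑ χ : MulChar F ℂ, (if χ ^ n = 1 then 1 else √(Fintype.card F)) =
      (Fintype.card F - 1).gcd n + (Fintype.card F - 1 - (Fintype.card F - 1).gcd n) *
          √(Fintype.card F) := by
    have hc := card_filter_add_card_filter_not (s := (univ : Finset (MulChar F ℂ)))
      (fun χ ↦ χ ^ n = 1)
    rw [card_univ] at hc
    have hc' := congrArg (Nat.cast (R := ℝ)) hc
    rw [Nat.cast_add, hcard] at hc'
    rw [sum_ite, sum_const, sum_const, nsmul_eq_mul, nsmul_eq_mul, eq_sub_of_add_eq' hc',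
      MulChar.card_filter_pow_eq_one, mul_one]
  rw [← add_sum_erase _ _ (mem_univ (1 : MulChar F ℂ)), one_pow, if_pos rfl] at hsum
  have h := card_norm_trace_eq_sum (E := E) (b := b) hψ ha
  rw [← add_sum_erase _ _ (mem_univ (1 : MulChar F ℂ)), sum_norm_trace_one hψ hb, inv_one,
    MulChar.one_apply ha.isUnit, one_mul, ← sub_eq_iff_eq_add'] at h
  calc _ = ‖((Fintype.card F : ℂ) - 1) * Fintype.card F *
        Nat.card {z : E // Algebra.norm F z = a ∧ Algebra.trace F E z = b} - Fintype.card E‖ := by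
        rw [← Real.norm_eq_abs, ← Complex.norm_real]
        push_cast
        rfl
    _ ≤ ∑ χ ∈ univ.erase (1 : MulChar F ℂ),
          √(Fintype.card E) * if χ ^ n = 1 then 1 else √(Fintype.card F) := by
        rw [h]
        refine norm_sum_le_of_le _ fun χ hχ ↦ ?_
        rw [norm_mul, norm_sum_norm_trace hψ (by simpa using hχ) hb]
        refine mul_le_of_le_one_left (by positivity) (le_of_eq ?_)
        exact Complex.norm_eq_one_of_mem_rootsOfUnity
          (χ⁻¹.apply_mem_rootsOfUnity (Units.mk0 a ha))
    _ = _ := by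
        rw [← mul_sum, eq_sub_of_add_eq' hsum]
        ring

end Characters

/-- improved bound on `N_n(a,b)` with `d = gcd(q-1, n)`. -/
theorem stmt4 (q n : ℕ) (hq : IsPrimePow q) (hn : 2 ≤ n)
    (Fq Fqn : Type) [Field Fq] [Field Fqn] [Fintype Fq] [Fintype Fqn]
    [Algebra Fq Fqn]
    (hcard : Fintype.card Fq = q) (hcardn : Fintype.card Fqn = q ^ n)
    (a b : Fq) (ha : a ≠ 0) (hb : b ≠ 0)
    (d : ℕ) (hd : d = Nat.gcd (q - 1) n) :
    |(Nat.card {z : Fqn // Algebra.norm Fq z = a ∧ Algebra.trace Fq Fqn z = b} : ℝ)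
        - ((q : ℝ) ^ (n - 1) - 1) / ((q : ℝ) - 1)|
      ≤ (1 + ((q : ℝ) - 2) * (q : ℝ) ^ (((n : ℝ) - 1) / 2)
          - (q : ℝ) ^ (((n : ℝ) - 2) / 2) * ((q : ℝ) ^ ((1 : ℝ) / 2) - 1) * ((d : ℝ) - 1))
        / ((q : ℝ) - 1) := by
  have hq1 : (1 : ℝ) < q := by exact_mod_cast hq.one_lt
  have hq0 : (0 : ℝ) < q := by positivity
  have hfin : Module.finrank Fq Fqn = n := by
    have h := Module.card_eq_pow_finrank (K := Fq) (V := Fqn)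
    rw [hcard, hcardn] at h
    exact (Nat.pow_right_injective hq.one_lt h).symm
  have key := abs_card_norm_trace_sub_le (E := Fqn) ha hb
  rw [hfin, hcard, hcardn, ← hd] at key
  set N := Nat.card {z : Fqn // Algebra.norm Fq z = a ∧ Algebra.trace Fq Fqn z = b}
  set t := (q : ℝ) ^ (((n : ℝ) - 2) / 2) with ht
  have hs : (q : ℝ) ^ ((1 : ℝ) / 2) = √q := (Real.sqrt_eq_rpow _).symm
  have hts : (q : ℝ) ^ (((n : ℝ) - 1) / 2) = t * √q := by
    rw [← hs, ht, ← Real.rpow_add hq0]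
    ring_nf
  have htq : √((q ^ n : ℕ) : ℝ) = q * t := by
    rw [Real.sqrt_eq_rpow, Nat.cast_pow, ← Real.rpow_natCast, ← Real.rpow_mul hq0.le, ht]
    nth_rewrite 2 [← Real.rpow_one (q : ℝ)]
    rw [← Real.rpow_add hq0]
    ring_nf
  have hpow : ((q ^ n : ℕ) : ℝ) = q * (q : ℝ) ^ (n - 1) := by
    rw [Nat.cast_pow, ← pow_succ', Nat.sub_add_cancel (by lia)]
  rw [htq, hpow, show ((q : ℝ) - 1) * q * N - q * (q : ℝ) ^ (n - 1) =
    q * ((q - 1) * N - (q : ℝ) ^ (n - 1)) by ring, abs_mul, abs_of_pos hq0, mul_assoc,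
    mul_le_mul_iff_right₀ hq0] at key
  have hq1' : (0 : ℝ) < q - 1 := by linarith
  rw [hts, hs, le_div_iff₀ hq1', ← abs_of_pos hq1', ← abs_mul, abs_of_pos hq1', sub_mul,
    div_mul_cancel₀ _ hq1'.ne']
  calc _ = |((q - 1) * N - (q : ℝ) ^ (n - 1)) + 1| := by ring_nf
    _ ≤ |(q - 1) * N - (q : ℝ) ^ (n - 1)| + |1| := abs_add_le _ _
    _ ≤ t * ((d - 1) + (q - 1 - d) * √q) + 1 := by rw [abs_one]; gcongr
    _ = _ := by ring
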